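/- Let f : ℝ^d → ℝ be convex, twice continuously differentiable with positive definite Hessian everywhere, semi-strongly self-concordant with constant L_semi > 0, and let x* be a global minimizer of f. Let α > 0, θ := 1 + α, and L ≥ (1 + ᾱ)^{3/2} L_semi; let B_0 be an (α̲, ᾱ)-relative inexact Hessian of f at x_0 with α ≥ max(α̲, ᾱ), and let x_1 := x_0 − η_0 B_0⁻¹ ∇f(x_0) be the CEQN step, where η_0 is the unique positive solution of L η_0² ‖∇f(x_0)‖_{B_0}^* + θ η_0 = 1. Suppose ‖∇f(x_1)‖_{B_0}^* ≥ (8/3) α² / L, and let D̄ > 0 satisfy ‖x_0 − x*‖_{B_0} + ‖∇f(x_0)‖_{B_0}^* ≤ D̄. Then ‖∇f(x_1)‖_{B_0}^* ≤ 24 L D̄² and f(x_1) − f(x*) ≤ 24 L D̄³. -/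

import Mathlib

open scoped RealInnerProductSpace

/-- The action of a `d × d` matrix on a vector of `EuclideanSpace ℝ (Fin d)`. -/
noncomputable def mulV {d : ℕ} (B : Matrix (Fin d) (Fin d) ℝ)
    (v : EuclideanSpace ℝ (Fin d)) : EuclideanSpace ℝ (Fin d) :=
  (EuclideanSpace.equiv (Fin d) ℝ).symm (B.mulVec ((EuclideanSpace.equiv (Fin d) ℝ) v))

/-- The `B`-norm `‖h‖_B = ⟨h, B h⟩^{1/2}`. -/
noncomputable def normB {d : ℕ} (B : Matrix (Fin d) (Fin d) ℝ)
    (h : EuclideanSpace ℝ (Fin d)) : ℝ :=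
  Real.sqrt ⟪h, mulV B h⟫

/-- The dual norm `‖g‖_B^* = ⟨g, B⁻¹ g⟩^{1/2}`. -/
noncomputable def dualNormB {d : ℕ} (B : Matrix (Fin d) (Fin d) ℝ)
    (g : EuclideanSpace ℝ (Fin d)) : ℝ :=
  Real.sqrt ⟪g, mulV B⁻¹ g⟫

/-- The Hessian of `f` at `x`, as a `d × d` matrix (matrix of the Fréchet derivative
of the gradient). -/
noncomputable def hessM {d : ℕ} (f : EuclideanSpace ℝ (Fin d) → ℝ)
    (x : EuclideanSpace ℝ (Fin d)) : Matrix (Fin d) (Fin d) ℝ :=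
  fun i j => (fderiv ℝ (gradient f) x (EuclideanSpace.single j (1 : ℝ))) i

/-- `f` is semi-strongly self-concordant with constant `Ls`:
`‖(∇²f(y) − ∇²f(x)) h‖_{∇²f(x)}^* ≤ Ls ‖y − x‖_{∇²f(x)} ‖h‖_{∇²f(x)}` for all `x y h`. -/
def SemiStrongSelfConcordant {d : ℕ} (f : EuclideanSpace ℝ (Fin d) → ℝ) (Ls : ℝ) : Prop :=
  ∀ x y h : EuclideanSpace ℝ (Fin d),
    dualNormB (hessM f x) (mulV (hessM f y - hessM f x) h) ≤
      Ls * normB (hessM f x) (y - x) * normB (hessM f x) h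

/-- `Bx` is an `(al, au)`-relative inexact Hessian of `f` at `x`:
`Bx` is symmetric positive definite, `0 ≤ al ≤ 1`, `0 ≤ au`, and
`(1 − al) Bx ⪯ ∇²f(x) ⪯ (1 + au) Bx` in the Loewner order. -/
def RelInexactHessian {d : ℕ} (f : EuclideanSpace ℝ (Fin d) → ℝ)
    (x : EuclideanSpace ℝ (Fin d)) (al au : ℝ) (Bx : Matrix (Fin d) (Fin d) ℝ) : Prop :=
  0 ≤ al ∧ al ≤ 1 ∧ 0 ≤ au ∧ Bx.PosDef ∧
    (hessM f x - (1 - al) • Bx).PosSemidef ∧ ((1 + au) • Bx - hessM f x).PosSemidef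

/-- The inexact second-order model
`Q̄_f(y;x) = f(x) + ⟨∇f(x), y − x⟩ + ½⟨B_x(y − x), y − x⟩`. -/
noncomputable def Qbar {d : ℕ} (f : EuclideanSpace ℝ (Fin d) → ℝ)
    (Bx : Matrix (Fin d) (Fin d) ℝ) (x y : EuclideanSpace ℝ (Fin d)) : ℝ :=
  f x + ⟪gradient f x, y - x⟫ + (1 / 2) * ⟪mulV Bx (y - x), y - x⟫


lemma mulV_add {d : ℕ} (B : Matrix (Fin d) (Fin d) ℝ) (u v) : mulV B (u+v) = mulV B u + mulV B v := by
  simp [mulV, Matrix.mulVec_add]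
lemma mulV_sub {d : ℕ} (B : Matrix (Fin d) (Fin d) ℝ) (u v) : mulV B (u-v) = mulV B u - mulV B v := by
  simp [mulV, Matrix.mulVec_sub]
lemma mulV_smul {d : ℕ} (B : Matrix (Fin d) (Fin d) ℝ) (c : ℝ) (v) : mulV B (c • v) = c • mulV B v := by
  simp [mulV, Matrix.mulVec_smul]
lemma sub_mulV {d : ℕ} (A B : Matrix (Fin d) (Fin d) ℝ) (v) : mulV (A - B) v = mulV A v - mulV B v := by
  simp [mulV, Matrix.sub_mulVec]
lemma smul_mulV {d : ℕ} (B : Matrix (Fin d) (Fin d) ℝ) (c : ℝ) (v) : mulV (c • B) v = c • mulV B v := by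
  simp [mulV, Matrix.smul_mulVec]
lemma mulV_mulV_inv {d : ℕ} (B : Matrix (Fin d) (Fin d) ℝ) (hB : B.PosDef) (v) :
    mulV B (mulV B⁻¹ v) = v := by
  have : IsUnit B.det := hB.det_pos.ne'.isUnit
  have h : B.mulVec (B⁻¹.mulVec v.ofLp) = v.ofLp := by
    rw [Matrix.mulVec_mulVec, Matrix.mul_nonsing_inv B this, Matrix.one_mulVec]
  exact congrArg (WithLp.toLp 2) h
lemma inner_mulV {d : ℕ} (B : Matrix (Fin d) (Fin d) ℝ) (u v : EuclideanSpace ℝ (Fin d)) :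
    ⟪u, mulV B v⟫ = u.ofLp ⬝ᵥ B.mulVec v.ofLp := by
  simp [mulV, EuclideanSpace.inner_eq_star_dotProduct, dotProduct_comm]
  rfl
lemma mulV_symm {d : ℕ} (B : Matrix (Fin d) (Fin d) ℝ) (hB : B.IsHermitian)
    (u v : EuclideanSpace ℝ (Fin d)) : ⟪u, mulV B v⟫ = ⟪v, mulV B u⟫ := by
  rw [inner_mulV, inner_mulV, Matrix.dotProduct_mulVec, ← Matrix.mulVec_transpose, dotProduct_comm]
  have : B.transpose = B := by simpa [Matrix.IsHermitian] using hB
  rw [this]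
lemma psd_mulV {d : ℕ} (B : Matrix (Fin d) (Fin d) ℝ) (hB : B.PosSemidef)
    (u : EuclideanSpace ℝ (Fin d)) : 0 ≤ ⟪u, mulV B u⟫ := by
  rw [inner_mulV]; simpa using hB.dotProduct_mulVec_nonneg u.ofLp
lemma normB_sq {d : ℕ} (B : Matrix (Fin d) (Fin d) ℝ) (hB : B.PosSemidef)
    (u : EuclideanSpace ℝ (Fin d)) : normB B u ^ 2 = ⟪u, mulV B u⟫ :=
  Real.sq_sqrt (psd_mulV B hB u)
lemma normB_nonneg {d : ℕ} (B : Matrix (Fin d) (Fin d) ℝ) 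
    (u : EuclideanSpace ℝ (Fin d)) : 0 ≤ normB B u := Real.sqrt_nonneg _
lemma normB_smul {d : ℕ} (B : Matrix (Fin d) (Fin d) ℝ) (c : ℝ) (hc : 0 ≤ c)
    (u : EuclideanSpace ℝ (Fin d)) : normB B (c • u) = c * normB B u := by
  unfold normB
  rw [mulV_smul, real_inner_smul_left, real_inner_smul_right, ← mul_assoc,
    Real.sqrt_mul (by positivity), Real.sqrt_mul_self hc]
lemma normB_neg {d : ℕ} (B : Matrix (Fin d) (Fin d) ℝ) 
    (u : EuclideanSpace ℝ (Fin d)) : normB B (-u) = normB B u := by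
  unfold normB
  have : mulV B (-u) = - mulV B u := by simpa using mulV_smul B (-1) u
  rw [this, inner_neg_neg]
lemma normB_eq_zero {d : ℕ} (B : Matrix (Fin d) (Fin d) ℝ) (hB : B.PosDef)
    (u : EuclideanSpace ℝ (Fin d)) (h : normB B u = 0) : u = 0 := by
  by_contra hu
  have h1 : 0 < u.ofLp ⬝ᵥ B.mulVec u.ofLp := by
    simpa using hB.dotProduct_mulVec_pos (x := u.ofLp) (by simpa using hu)
  have := normB_sq B hB.posSemidef u
  rw [inner_mulV, h] at this
  linarith
lemma bilin_bound {d : ℕ} (M B : Matrix (Fin d) (Fin d) ℝ) (hM : M.IsHermitian) (hB : B.PosDef)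
    (c : ℝ) (h1 : ∀ u : EuclideanSpace ℝ (Fin d), ⟪u, mulV M u⟫ ≤ c * ⟪u, mulV B u⟫)
    (h2 : ∀ u : EuclideanSpace ℝ (Fin d), -(c * ⟪u, mulV B u⟫) ≤ ⟪u, mulV M u⟫)
    (u v : EuclideanSpace ℝ (Fin d)) : ⟪mulV M u, v⟫ ≤ c * normB B u * normB B v := by
  rw [real_inner_comm]
  by_cases ha : normB B u = 0
  · rw [normB_eq_zero B hB u ha]; have := mulV_smul M 0 0
    simp at this; simp [this, normB]
  by_cases hb : normB B v = 0
  · rw [normB_eq_zero B hB v hb]; simp [normB]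
  have ha' := lt_of_le_of_ne (normB_nonneg B u) (Ne.symm ha)
  have hb' := lt_of_le_of_ne (normB_nonneg B v) (Ne.symm hb)
  have hu := normB_sq B hB.posSemidef u
  have hv := normB_sq B hB.posSemidef v
  set a := normB B u
  set b := normB B v
  have e1 := h1 (b • u + a • v)
  have e2 := h2 (b • u - a • v)
  simp only [mulV_add, mulV_sub, mulV_smul, inner_add_left, inner_add_right, inner_sub_left,
    inner_sub_right, real_inner_smul_left, real_inner_smul_right] at e1 e2
  rw [mulV_symm M hM u v, mulV_symm B hB.isHermitian u v, ← hu, ← hv] at e1 e2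
  have : (a * b) * ⟪v, mulV M u⟫ ≤ (a * b) * (c * a * b) := by nlinarith
  exact le_of_mul_le_mul_left this (by positivity)
lemma cs_B {d : ℕ} (B : Matrix (Fin d) (Fin d) ℝ) (hB : B.PosDef)
    (u v : EuclideanSpace ℝ (Fin d)) : ⟪mulV B u, v⟫ ≤ normB B u * normB B v := by
  have := bilin_bound B B hB.isHermitian hB 1 (fun u => by simp)
    (fun u => by linarith [psd_mulV B hB.posSemidef u]) u v
  simpa using this
lemma dual_eq {d : ℕ} (B : Matrix (Fin d) (Fin d) ℝ) (hB : B.PosDef)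
    (g : EuclideanSpace ℝ (Fin d)) : dualNormB B g = normB B (mulV B⁻¹ g) := by
  unfold dualNormB normB; rw [mulV_mulV_inv B hB, real_inner_comm]
lemma cs_dual {d : ℕ} (B : Matrix (Fin d) (Fin d) ℝ) (hB : B.PosDef)
    (g v : EuclideanSpace ℝ (Fin d)) : ⟪g, v⟫ ≤ dualNormB B g * normB B v := by
  have := cs_B B hB (mulV B⁻¹ g) v
  rwa [mulV_mulV_inv B hB, ← dual_eq B hB] at this
lemma dual_le {d : ℕ} (B : Matrix (Fin d) (Fin d) ℝ) (hB : B.PosDef)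
    (g : EuclideanSpace ℝ (Fin d)) (c : ℝ) (hc : 0 ≤ c) (h : ∀ v, ⟪g, v⟫ ≤ c * normB B v) :
    dualNormB B g ≤ c := by
  have h1 := h (mulV B⁻¹ g)
  have h2 : dualNormB B g ^ 2 = ⟪g, mulV B⁻¹ g⟫ := by
    rw [dual_eq B hB, normB_sq B hB.posSemidef, mulV_mulV_inv B hB, real_inner_comm]
  rw [← h2, ← dual_eq B hB] at h1
  by_contra hlt
  push Not at hlt
  nlinarith
lemma normB_add_le {d : ℕ} (B : Matrix (Fin d) (Fin d) ℝ) (hB : B.PosDef)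
    (u v : EuclideanSpace ℝ (Fin d)) : normB B (u + v) ≤ normB B u + normB B v := by
  have h := cs_B B hB u v
  rw [real_inner_comm] at h
  have e := normB_sq B hB.posSemidef (u+v)
  simp only [mulV_add, inner_add_left, inner_add_right] at e
  rw [mulV_symm B hB.isHermitian u v, ← normB_sq B hB.posSemidef, ← normB_sq B hB.posSemidef] at e
  have := normB_nonneg B u
  have := normB_nonneg B v
  exact abs_le_of_sq_le_sq' (by nlinarith) (by positivity) |>.2

lemma hess_apply {d : ℕ} (f : EuclideanSpace ℝ (Fin d) → ℝ) (x v : EuclideanSpace ℝ (Fin d)) :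
    fderiv ℝ (gradient f) x v = mulV (hessM f x) v := by
  have hv : v = ∑ j, v j • EuclideanSpace.single j (1:ℝ) := by
    ext i; simp [Finset.sum_apply, Pi.single_apply]
  conv_lhs => rw [hv]
  rw [map_sum]
  ext i
  simp [mulV, hessM, Matrix.mulVec, dotProduct, mul_comm]
lemma grad_contDiff {d : ℕ} (f : EuclideanSpace ℝ (Fin d) → ℝ) (hC2 : ContDiff ℝ 2 f) :
    ContDiff ℝ 1 (gradient f) := by
  have h : ContDiff ℝ 1 (fderiv ℝ f) := hC2.fderiv_right (by norm_num)
  exact (InnerProductSpace.toDual ℝ (EuclideanSpace ℝ (Fin d))).symm.contDiff.comp h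
lemma convex_grad {d : ℕ} (f : EuclideanSpace ℝ (Fin d) → ℝ)
    (hconv : ConvexOn ℝ Set.univ f) (hC2 : ContDiff ℝ 2 f) (x y : EuclideanSpace ℝ (Fin d)) :
    f x - f y ≤ ⟪gradient f x, x - y⟫ := by
  have hd : DifferentiableAt ℝ f x := hC2.differentiable (by norm_num) x
  have h1 : ConvexOn ℝ Set.univ (f ∘ AffineMap.lineMap (k := ℝ) x y) := by
    simpa using hconv.comp_affineMap (AffineMap.lineMap (k := ℝ) x y)
  have h2 : HasDerivAt (f ∘ AffineMap.lineMap (k := ℝ) x y) (fderiv ℝ f x (y - x)) 0 := by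
    refine HasFDerivAt.comp_hasDerivAt (0:ℝ) ?_ AffineMap.hasDerivAt_lineMap
    simpa using hd.hasFDerivAt
  have h3 := h1.le_slope_of_hasDerivAt (Set.mem_univ 0) (Set.mem_univ 1) one_pos h2
  have h4 : ⟪gradient f x, y - x⟫ = fderiv ℝ f x (y - x) := by
    simp [gradient]
  simp [slope_def_field] at h3
  have h5 : ⟪gradient f x, x - y⟫ = - ⟪gradient f x, y - x⟫ := by
    rw [← inner_neg_right, neg_sub]
  rw [h5, h4, map_sub]; linarith

lemma taylor_grad {d : ℕ} (f : EuclideanSpace ℝ (Fin d) → ℝ) (hC2 : ContDiff ℝ 2 f)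
    (hpd : ∀ x, (hessM f x).PosDef)
    (Ls : ℝ) (hssc : SemiStrongSelfConcordant f Ls)
    (x v h : EuclideanSpace ℝ (Fin d)) :
    ⟪gradient f (x + v), h⟫ ≤ ⟪gradient f x, h⟫ + ⟪mulV (hessM f x) v, h⟫
      + Ls / 2 * normB (hessM f x) v ^ 2 * normB (hessM f x) h := by
  set C := Ls * normB (hessM f x) v ^ 2 * normB (hessM f x) h with hC
  have hder : ∀ t : ℝ, HasDerivAt (fun t : ℝ => ⟪gradient f (x + t • v), h⟫
      - t * ⟪mulV (hessM f x) v, h⟫ - t ^ 2 / 2 * C)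
      (⟪mulV (hessM f (x + t • v)) v, h⟫ - ⟪mulV (hessM f x) v, h⟫ - t * C) t := by
    intro t
    have h1 : HasDerivAt (fun t : ℝ => x + t • v) v t := by
      simpa using ((hasDerivAt_id t).smul_const v).const_add x
    have h2 : HasDerivAt (fun t : ℝ => gradient f (x + t • v))
        (mulV (hessM f (x + t • v)) v) t := by
      rw [← hess_apply]
      exact (((grad_contDiff f hC2).differentiable (by norm_num) _).hasFDerivAt).comp_hasDerivAt t h1
    have h3 := h2.inner ℝ (hasDerivAt_const t h)
    have h4 := (hasDerivAt_id t).mul_const ⟪mulV (hessM f x) v, h⟫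
    have h5 := (((hasDerivAt_id t).pow 2).div_const 2).mul_const C
    refine ((h3.sub h4).sub h5).congr_deriv ?_
    simp
  have hanti := antitoneOn_of_deriv_nonpos (convex_Icc (0:ℝ) 1)
    (fun t _ => (hder t).continuousAt.continuousWithinAt)
    (fun t _ => (hder t).differentiableAt.differentiableWithinAt)
    (fun t ht => by
      rw [interior_Icc] at ht
      rw [(hder t).deriv]
      have e1 := hssc x (x + t • v) v
      rw [add_sub_cancel_left, normB_smul _ _ ht.1.le] at e1
      have e2 := cs_dual (hessM f x) (hpd x) (mulV (hessM f (x + t • v) - hessM f x) v) h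
      have e3 := mul_le_mul_of_nonneg_right e1 (normB_nonneg (hessM f x) h)
      rw [sub_mulV, inner_sub_left] at e2
      rw [sub_mulV] at e3
      have : Ls * (t * normB (hessM f x) v) * normB (hessM f x) v * normB (hessM f x) h = t * C := by
        rw [hC]; ring
      linarith)
  have := hanti (by simp) (by simp) (zero_le_one)
  simp only [one_smul, zero_smul, add_zero] at this
  have hC2 : Ls / 2 * normB (hessM f x) v ^ 2 * normB (hessM f x) h = C / 2 := by rw [hC]; ring
  rw [hC2]; linarith

lemma scalar_bound (α L r G1 : ℝ) (hα : 0 < α) (hLpos : 0 < L) (hr0 : 0 ≤ r)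
    (hα2 : 8 / 3 * α ^ 2 ≤ G1 * L) (hmain : G1 ≤ 2 * α * r + 3 / 2 * L * r ^ 2) :
    G1 ≤ 4 * L * r ^ 2 := by
  by_contra hlt
  push Not at hlt
  have k2 : 5 / 4 * (L * r) < α := by
    have k1 : (5 / 4 * (L * r)) * r < α * r := by linarith
    exact lt_of_mul_lt_mul_right k1 hr0
  have k3 := mul_le_mul_of_nonneg_right hmain hLpos.le
  have k4 : 0 ≤ L * r := by positivity
  have k5 : (2 * α * r + 3 / 2 * L * r ^ 2) * L = 2 * α * (L * r) + 3 / 2 * (L * r) ^ 2 := by ring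
  rw [k5] at k3
  set p := L * r
  have k6 : p * (5 / 4 * p) ≤ p * α := mul_le_mul_of_nonneg_left k2.le k4
  have k7 : α * (5 / 4 * p) < α * α := mul_lt_mul_of_pos_left k2 hα
  nlinarith [mul_pos hα hα]

set_option maxHeartbeats 2000000

/-- first-iterate bounds for the CEQN method. -/
theorem stmt15 {d : ℕ} (f : EuclideanSpace ℝ (Fin d) → ℝ)
    (hconv : ConvexOn ℝ Set.univ f) (hC2 : ContDiff ℝ 2 f)
    (hpd : ∀ x, (hessM f x).PosDef)
    (Ls : ℝ) (hLs : 0 < Ls) (hssc : SemiStrongSelfConcordant f Ls)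
    (xs : EuclideanSpace ℝ (Fin d)) (hmin : ∀ y, f xs ≤ f y)
    (al au α L : ℝ) (hα : 0 < α) (hαmax : max al au ≤ α)
    (hL : (1 + au) ^ ((3 : ℝ) / 2) * Ls ≤ L)
    (x0 x1 : EuclideanSpace ℝ (Fin d)) (B0 : Matrix (Fin d) (Fin d) ℝ)
    (hrel : RelInexactHessian f x0 al au B0)
    (η0 : ℝ) (hη0 : 0 < η0)
    (heq : L * η0 ^ 2 * dualNormB B0 (gradient f x0) + (1 + α) * η0 = 1)
    (hstep : x1 = x0 - η0 • mulV B0⁻¹ (gradient f x0))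
    (hgrad : 8 / 3 * α ^ 2 / L ≤ dualNormB B0 (gradient f x1))
    (Db : ℝ) (hDb : 0 < Db)
    (hD : normB B0 (x0 - xs) + dualNormB B0 (gradient f x0) ≤ Db) :
    dualNormB B0 (gradient f x1) ≤ 24 * L * Db ^ 2 ∧ f x1 - f xs ≤ 24 * L * Db ^ 3 := by
  obtain ⟨hal0, hal1, hau, hB, hlo, hup⟩ := hrel
  have hLpos : 0 < L := lt_of_lt_of_le (by positivity) hL
  have halα := (le_max_left _ _).trans hαmax
  have hauα := (le_max_right _ _).trans hαmax
  have hG0n : 0 ≤ dualNormB B0 (gradient f x0) := Real.sqrt_nonneg _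
  have hG1n : 0 ≤ dualNormB B0 (gradient f x1) := Real.sqrt_nonneg _
  set w := mulV B0⁻¹ (gradient f x0) with hw
  set G0 := dualNormB B0 (gradient f x0) with hG0
  set G1 := dualNormB B0 (gradient f x1) with hG1
  set H := hessM f x0 with hH
  set v := -(η0 • w) with hv
  have hx1 : x1 = x0 + v := by rw [hstep, hv, sub_eq_add_neg]
  have hr : normB B0 v = η0 * G0 := by
    rw [hv, normB_neg, normB_smul _ _ hη0.le, hG0, dual_eq B0 hB]
  have hη1 : η0 ≤ 1 := by nlinarith [mul_nonneg (mul_nonneg hLpos.le (sq_nonneg η0)) hG0n, mul_pos hα hη0]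
  have hrG : η0 * G0 ≤ G0 := by nlinarith
  have hHB : ∀ u : EuclideanSpace ℝ (Fin d), ⟪u, mulV H u⟫ ≤ (1 + au) * ⟪u, mulV B0 u⟫ := by
    intro u
    have := psd_mulV _ hup u
    rw [sub_mulV, smul_mulV, inner_sub_right, real_inner_smul_right] at this
    linarith
  have hHB' : ∀ u : EuclideanSpace ℝ (Fin d), (1 - al) * ⟪u, mulV B0 u⟫ ≤ ⟪u, mulV H u⟫ := by
    intro u
    have := psd_mulV _ hlo u
    rw [sub_mulV, smul_mulV, inner_sub_right, real_inner_smul_right] at this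
    linarith
  have hnH : ∀ u, normB H u ≤ Real.sqrt (1 + au) * normB B0 u := by
    intro u
    unfold normB
    rw [← Real.sqrt_mul (by positivity)]
    exact Real.sqrt_le_sqrt (hHB u)
  set r := η0 * G0 with hrdef
  have hr0 : 0 ≤ r := by positivity
  have hmain : G1 ≤ 2 * α * r + 3 / 2 * L * r ^ 2 := by
    refine dual_le B0 hB _ _ (by positivity) fun h => ?_
    have hh := normB_nonneg B0 h
    have t1 := taylor_grad f hC2 hpd Ls hssc x0 v h
    rw [← hx1] at t1
    have t2 : ⟪mulV (H - B0) v, h⟫ ≤ α * normB B0 v * normB B0 h := by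
      refine bilin_bound _ _ ((hpd x0).isHermitian.sub hB.isHermitian) hB α ?_ ?_ v h
      · intro u
        rw [sub_mulV, inner_sub_right]
        nlinarith [hHB u, psd_mulV B0 hB.posSemidef u]
      · intro u
        rw [sub_mulV, inner_sub_right]
        nlinarith [hHB' u, psd_mulV B0 hB.posSemidef u]
    rw [sub_mulV, inner_sub_left, hr] at t2
    have t3 : mulV B0 v = -(η0 • gradient f x0) := by
      have : v = (-η0) • w := by rw [hv, neg_smul]
      rw [this, mulV_smul, hw, mulV_mulV_inv B0 hB, neg_smul]
    have t4 : ⟪mulV B0 v, h⟫ = - (η0 * ⟪gradient f x0, h⟫) := by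
      rw [t3, inner_neg_left, real_inner_smul_left]
    have t5 := cs_dual B0 hB (gradient f x0) h
    rw [← hG0] at t5
    have t6 := mul_le_mul_of_nonneg_left t5 (sub_nonneg.2 hη1)
    have t7 : (1 - η0) * (G0 * normB B0 h) = (α * r + L * r ^ 2) * normB B0 h := by
      have : 1 - η0 = α * η0 + L * η0 ^ 2 * G0 := by linarith
      rw [this, hrdef]; ring
    have t8 : Ls / 2 * normB H v ^ 2 * normB H h ≤ L / 2 * r ^ 2 * normB B0 h := by
      have s1 : normB H v ^ 2 ≤ (1 + au) * r ^ 2 := by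
        have := pow_le_pow_left₀ (normB_nonneg H v) (hnH v) 2
        rwa [hr, mul_pow, Real.sq_sqrt (by positivity)] at this
      have s2 : (1 + au) ^ ((3 : ℝ) / 2) = (1 + au) * Real.sqrt (1 + au) := by
        rw [Real.sqrt_eq_rpow, show (3:ℝ)/2 = 1 + 1/2 by norm_num,
          Real.rpow_add (by positivity), Real.rpow_one]
      rw [s2] at hL
      calc Ls / 2 * normB H v ^ 2 * normB H h
          ≤ Ls / 2 * ((1 + au) * r ^ 2) * (Real.sqrt (1 + au) * normB B0 h) := by
            gcongr
            · exact normB_nonneg _ _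
            · exact hnH h
        _ = ((1 + au) * Real.sqrt (1 + au) * Ls) * (r ^ 2 * normB B0 h / 2) := by ring
        _ ≤ L * (r ^ 2 * normB B0 h / 2) := by gcongr
        _ = _ := by ring
    nlinarith
  have hG4 : G1 ≤ 4 * L * r ^ 2 := by
    have hα2 : 8 / 3 * α ^ 2 ≤ G1 * L := by rwa [div_le_iff₀ hLpos] at hgrad
    exact scalar_bound α L r G1 hα hLpos hr0 hα2 hmain
  have hGD : G0 ≤ Db := by linarith [normB_nonneg B0 (x0 - xs)]
  have hrD : r ^ 2 ≤ Db ^ 2 := pow_le_pow_left₀ hr0 (hrG.trans hGD) 2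
  have hfin : G1 ≤ 24 * L * Db ^ 2 := by nlinarith [mul_le_mul_of_nonneg_left hrD hLpos.le, mul_nonneg hLpos.le (sq_nonneg Db)]
  refine ⟨hfin, ?_⟩
  have c1 := convex_grad f hconv hC2 x1 xs
  have c2 := cs_dual B0 hB (gradient f x1) (x1 - xs)
  have c3 : normB B0 (x1 - xs) ≤ Db := by
    have : x1 - xs = v + (x0 - xs) := by rw [hx1]; abel
    rw [this]
    have := normB_add_le B0 hB v (x0 - xs)
    linarith
  calc f x1 - f xs ≤ G1 * normB B0 (x1 - xs) := c1.trans c2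
    _ ≤ (24 * L * Db ^ 2) * Db := mul_le_mul hfin c3 (normB_nonneg _ _) (by positivity)
    _ = _ := by ring
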